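/- arXiv:2301.05674 — 2 statements merged into one kernel-verified Lean document; each statement's English description precedes it below -/
import Mathlib

section
/- Let G be a network of friends on N = {1,…,n}, let Γ and Δ be coalition structures on N, and let i ∈ N. If M ≥ n² and min_{f ∈ F_i} v_f(Γ) > min_{f ∈ F_i} v_f(Δ), then u^minAL_i(Γ) > u^minAL_i(Δ), i.e., player i strictly prefers Γ to Δ under min-based altruistic-treatment preferences. -/
namespace ACFG

/-- A coalition structure on the player set `Fin n` (the players `1,…,n`), represented by
the map sending each player to her coalition (her block of the partition). -/
structure CoalitionStructure (n : ℕ) where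
  block : Fin n → Finset (Fin n)
  mem_block : ∀ i, i ∈ block i
  block_eq : ∀ i j, j ∈ block i → block j = block i

variable {n : ℕ}

/-- The set `F_i` of friends of player `i` in the network of friends `G`. -/
def friends (G : SimpleGraph (Fin n)) [DecidableRel G.Adj] (i : Fin n) : Finset (Fin n) :=
  Finset.univ.filter (fun j => G.Adj i j)

/-- The set `E_i` of enemies of player `i`: all players other than `i` and her friends. -/
def enemies (G : SimpleGraph (Fin n)) [DecidableRel G.Adj] (i : Fin n) : Finset (Fin n) :=
  (insert i (friends G i))ᶜ

/-- The friend-oriented value of player `i` for the coalition structure `Γ`: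
`v_i(Γ) = n·|Γ(i) ∩ F_i| − |Γ(i) ∩ E_i|`. -/
def val (G : SimpleGraph (Fin n)) [DecidableRel G.Adj] (Γ : CoalitionStructure n)
    (i : Fin n) : ℤ :=
  (n : ℤ) * ((Γ.block i ∩ friends G i).card : ℤ) - ((Γ.block i ∩ enemies G i).card : ℤ)

/-- `sumF_i(Γ)`: the sum of the values of `i`'s friends. -/
def sumF (G : SimpleGraph (Fin n)) [DecidableRel G.Adj] (Γ : CoalitionStructure n)
    (i : Fin n) : ℤ :=
  ∑ f ∈ friends G i, val G Γ f

/-- `sumF+_i(Γ)`: the sum of the values of `i`'s friends and of `i` herself. -/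
def sumFplus (G : SimpleGraph (Fin n)) [DecidableRel G.Adj] (Γ : CoalitionStructure n)
    (i : Fin n) : ℤ :=
  ∑ f ∈ insert i (friends G i), val G Γ f

/-- `minF_i(Γ)`: the minimum of the values of `i`'s friends (`0` if `i` has no friends). -/
def minF (G : SimpleGraph (Fin n)) [DecidableRel G.Adj] (Γ : CoalitionStructure n)
    (i : Fin n) : ℤ :=
  if h : (friends G i).Nonempty then (friends G i).inf' h (val G Γ) else 0

/-- `minF+_i(Γ)`: the minimum of the values of `i`'s friends and of `i` herself. -/
def minFplus (G : SimpleGraph (Fin n)) [DecidableRel G.Adj] (Γ : CoalitionStructure n)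
    (i : Fin n) : ℤ :=
  (insert i (friends G i)).inf' (Finset.insert_nonempty _ _) (val G Γ)

/-- Sum-based selfish-first utility: `u^sumSF_i(Γ) = M·v_i(Γ) + sumF_i(Γ)`. -/
def usumSF (G : SimpleGraph (Fin n)) [DecidableRel G.Adj] (M : ℤ) (Γ : CoalitionStructure n)
    (i : Fin n) : ℤ :=
  M * val G Γ i + sumF G Γ i

/-- Sum-based equal-treatment utility: `u^sumEQ_i(Γ) = sumF+_i(Γ)`. -/
def usumEQ (G : SimpleGraph (Fin n)) [DecidableRel G.Adj] (Γ : CoalitionStructure n)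
    (i : Fin n) : ℤ :=
  sumFplus G Γ i

/-- Sum-based altruistic-treatment utility: `u^sumAL_i(Γ) = v_i(Γ) + M·sumF_i(Γ)`. -/
def usumAL (G : SimpleGraph (Fin n)) [DecidableRel G.Adj] (M : ℤ) (Γ : CoalitionStructure n)
    (i : Fin n) : ℤ :=
  val G Γ i + M * sumF G Γ i

/-- Min-based selfish-first utility: `u^minSF_i(Γ) = M·v_i(Γ) + minF_i(Γ)`. -/
def uminSF (G : SimpleGraph (Fin n)) [DecidableRel G.Adj] (M : ℤ) (Γ : CoalitionStructure n)
    (i : Fin n) : ℤ :=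
  M * val G Γ i + minF G Γ i

/-- Min-based equal-treatment utility: `u^minEQ_i(Γ) = minF+_i(Γ)`. -/
def uminEQ (G : SimpleGraph (Fin n)) [DecidableRel G.Adj] (Γ : CoalitionStructure n)
    (i : Fin n) : ℤ :=
  minFplus G Γ i

/-- Min-based altruistic-treatment utility: `u^minAL_i(Γ) = v_i(Γ) + M·minF_i(Γ)`. -/
def uminAL (G : SimpleGraph (Fin n)) [DecidableRel G.Adj] (M : ℤ) (Γ : CoalitionStructure n)
    (i : Fin n) : ℤ :=
  val G Γ i + M * minF G Γ i

/-- The friends and the enemies of `i` make up all players other than `i`. -/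
theorem card_friends_add_card_enemies (G : SimpleGraph (Fin n)) [DecidableRel G.Adj]
    (i : Fin n) : (friends G i).card + (enemies G i).card + 1 = n := by
  have hi : i ∉ friends G i := by simp [friends]
  have h := Finset.card_add_card_compl (insert i (friends G i))
  rw [Finset.card_insert_of_notMem hi, Fintype.card_fin] at h
  rw [enemies]
  omega

theorem val_le (G : SimpleGraph (Fin n)) [DecidableRel G.Adj] (Γ : CoalitionStructure n)
    (i : Fin n) : val G Γ i ≤ n * (friends G i).card := by
  have h : ((Γ.block i ∩ friends G i).card : ℤ) ≤ (friends G i).card := by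
    exact_mod_cast Finset.card_le_card Finset.inter_subset_right
  have := mul_le_mul_of_nonneg_left h (Int.natCast_nonneg n)
  rw [val]
  omega

theorem neg_card_enemies_le_val (G : SimpleGraph (Fin n)) [DecidableRel G.Adj]
    (Γ : CoalitionStructure n) (i : Fin n) : -((enemies G i).card : ℤ) ≤ val G Γ i := by
  have h : ((Γ.block i ∩ enemies G i).card : ℤ) ≤ (enemies G i).card := by
    exact_mod_cast Finset.card_le_card Finset.inter_subset_right
  have : (0 : ℤ) ≤ n * ((Γ.block i ∩ friends G i).card : ℤ) := by positivity
  rw [val]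
  omega

/-- The values of a player for two coalition structures differ by less than `n²`. -/
theorem val_sub_val_lt (G : SimpleGraph (Fin n)) [DecidableRel G.Adj]
    (Γ Δ : CoalitionStructure n) (i : Fin n) : val G Δ i - val G Γ i < (n : ℤ) ^ 2 := by
  have hcard : ((friends G i).card : ℤ) + (enemies G i).card + 1 = n := by
    exact_mod_cast card_friends_add_card_enemies G i
  have hΔ := val_le G Δ i
  have hΓ := neg_card_enemies_le_val G Γ i
  have hF : (0 : ℤ) ≤ (friends G i).card := by positivity
  have hE : (0 : ℤ) ≤ (enemies G i).card := by positivity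
  nlinarith

/-- If `M ≥ n²` and `minF_i(Γ) > minF_i(Δ)`, then player `i` strictly
prefers `Γ` to `Δ` under min-based altruistic-treatment preferences. -/
theorem minAL_altruistic_first (G : SimpleGraph (Fin n)) [DecidableRel G.Adj] (M : ℤ)
    (hM : (n : ℤ) ^ 2 ≤ M) (Γ Δ : CoalitionStructure n) (i : Fin n)
    (h : minF G Δ i < minF G Γ i) :
    uminAL G M Δ i < uminAL G M Γ i := by
  have hv := val_sub_val_lt G Γ Δ i
  have hM0 : 0 ≤ M := (sq_nonneg (n : ℤ)).trans hM
  have hmul := mul_le_mul_of_nonneg_left (Int.add_one_le_of_lt h) hM0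
  rw [uminAL, uminAL]
  linarith

end ACFG
end

section
/- Sum-based equal-treatment preferences are type-I-monotonic and type-II-monotonic: let G be a network of friends on N = {1,…,n}, let i ∈ N, let j ∈ E_i, let Γ, Δ be coalition structures on N with v_j(Γ) ≥ v_j(Δ), and let G' be the graph obtained from G by adding the edge {i,j}; write u' for the sum-based equal-treatment utility in G'. If j ∈ Γ(i) ∩ Δ(i) or j ∈ Γ(i) \ Δ(i), then u^sumEQ_i(Γ) > u^sumEQ_i(Δ) implies u'^sumEQ_i(Γ) > u'^sumEQ_i(Δ), and u^sumEQ_i(Γ) = u^sumEQ_i(Δ) implies u'^sumEQ_i(Γ) ≥ u'^sumEQ_i(Δ). -/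
namespace ACFG

variable {n : ℕ}

/-- The graph `G'` obtained from `G` by adding the edge `{i, j}`. -/
def addEdge (G : SimpleGraph (Fin n)) (i j : Fin n) : SimpleGraph (Fin n) :=
  G ⊔ SimpleGraph.fromEdgeSet {s(i, j)}

instance (G : SimpleGraph (Fin n)) [DecidableRel G.Adj] (i j : Fin n) :
    DecidableRel (addEdge G i j).Adj := fun a b =>
  decidable_of_iff (G.Adj a b ∨ (s(a, b) = s(i, j) ∧ a ≠ b)) (by
    simp [addEdge, SimpleGraph.fromEdgeSet_adj])

theorem mem_friends {G : SimpleGraph (Fin n)} [DecidableRel G.Adj] {a b : Fin n} :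
    b ∈ friends G a ↔ G.Adj a b := by
  simp [friends]

theorem mem_enemies {G : SimpleGraph (Fin n)} [DecidableRel G.Adj] {a b : Fin n} :
    b ∈ enemies G a ↔ b ≠ a ∧ ¬ G.Adj a b := by
  simp [enemies, mem_friends]

theorem addEdge_adj {G : SimpleGraph (Fin n)} {i j a b : Fin n} :
    (addEdge G i j).Adj a b ↔ G.Adj a b ∨ (s(a, b) = s(i, j) ∧ a ≠ b) := by
  simp [addEdge, SimpleGraph.fromEdgeSet_adj]

theorem CoalitionStructure.mem_block_comm (Γ : CoalitionStructure n) {a b : Fin n} :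
    a ∈ Γ.block b ↔ b ∈ Γ.block a :=
  ⟨fun h => Γ.block_eq b a h ▸ Γ.mem_block b, fun h => Γ.block_eq a b h ▸ Γ.mem_block a⟩

/-- The value of a player with the same friends in two networks is the same in both. -/
theorem val_congr {G H : SimpleGraph (Fin n)} [DecidableRel G.Adj] [DecidableRel H.Adj]
    {a : Fin n} (h : friends H a = friends G a) (Γ : CoalitionStructure n) :
    val H Γ a = val G Γ a := by
  simp [val, enemies, h]

/-- When exactly one enemy `b` of `a` becomes a friend, the value of `a` grows by `n + 1` if
`b` is in the coalition of `a`, and is unchanged otherwise. -/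
theorem val_of_friends_eq_insert {G H : SimpleGraph (Fin n)} [DecidableRel G.Adj]
    [DecidableRel H.Adj] {a b : Fin n} (hb : b ∈ enemies G a)
    (h : friends H a = insert b (friends G a)) (Γ : CoalitionStructure n) :
    val H Γ a = val G Γ a + if b ∈ Γ.block a then (n : ℤ) + 1 else 0 := by
  have hbF : b ∉ friends G a := fun hF => (mem_enemies.1 hb).2 (mem_friends.1 hF)
  have hE : enemies H a = (enemies G a).erase b := by
    ext c
    simp only [enemies, h, Finset.mem_compl, Finset.mem_insert, Finset.mem_erase]
    tauto
  unfold val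
  rw [hE, h, Finset.inter_erase]
  split_ifs with hm
  · have hbE : b ∈ Γ.block a ∩ enemies G a := Finset.mem_inter.2 ⟨hm, hb⟩
    have hcard := Finset.card_erase_add_one hbE
    rw [Finset.inter_insert_of_mem hm, Finset.card_insert_of_notMem (by simp [hbF]), ← hcard]
    push_cast
    ring
  · rw [Finset.inter_insert_of_notMem hm, Finset.erase_eq_of_notMem (by simp [hm]), add_zero]

theorem friends_addEdge_left {G : SimpleGraph (Fin n)} [DecidableRel G.Adj] {i j : Fin n}
    (hij : i ≠ j) : friends (addEdge G i j) i = insert j (friends G i) := by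
  ext c
  simp only [mem_friends, addEdge_adj, Finset.mem_insert, Sym2.eq_iff]
  grind

theorem friends_addEdge_right {G : SimpleGraph (Fin n)} [DecidableRel G.Adj] {i j : Fin n}
    (hij : i ≠ j) : friends (addEdge G i j) j = insert i (friends G j) := by
  ext c
  simp only [mem_friends, addEdge_adj, Finset.mem_insert, Sym2.eq_iff]
  grind

theorem friends_addEdge_of_ne {G : SimpleGraph (Fin n)} [DecidableRel G.Adj] {i j a : Fin n}
    (hi : a ≠ i) (hj : a ≠ j) : friends (addEdge G i j) a = friends G a := by
  ext c
  simp only [mem_friends, addEdge_adj, Sym2.eq_iff]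
  grind

/-- Effect on `i`'s sum-based equal-treatment utility of turning an enemy `j` into a friend. -/
theorem usumEQ_addEdge {G : SimpleGraph (Fin n)} [DecidableRel G.Adj] {i j : Fin n}
    (hj : j ∈ enemies G i) (Γ : CoalitionStructure n) :
    usumEQ (addEdge G i j) Γ i =
      usumEQ G Γ i + val G Γ j + if j ∈ Γ.block i then 2 * ((n : ℤ) + 1) else 0 := by
  obtain ⟨hne, hadj⟩ := mem_enemies.1 hj
  have hi : i ∈ enemies G j := mem_enemies.2 ⟨hne.symm, fun h => hadj h.symm⟩
  have hiF : i ∉ friends G i := by simp [mem_friends]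
  have hjF : j ∉ friends G i := by simpa [mem_friends] using hadj
  have hsum : ∑ f ∈ friends G i, val (addEdge G i j) Γ f = ∑ f ∈ friends G i, val G Γ f :=
    Finset.sum_congr rfl fun f hf => val_congr
      (friends_addEdge_of_ne (ne_of_mem_of_not_mem hf hiF) (ne_of_mem_of_not_mem hf hjF)) Γ
  simp only [usumEQ, sumFplus]
  rw [friends_addEdge_left hne.symm, Finset.sum_insert (by simp [hne.symm, hiF]),
    Finset.sum_insert hjF, Finset.sum_insert hiF, hsum,
    val_of_friends_eq_insert hj (friends_addEdge_left hne.symm),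
    val_of_friends_eq_insert hi (friends_addEdge_right hne.symm)]
  simp only [Γ.mem_block_comm (a := i) (b := j)]
  split_ifs <;> ring

/-- Sum-based equal-treatment preferences are type-I- and
type-II-monotonic: if the enemy `j` of `i` satisfies `j ∈ Γ(i) ∩ Δ(i)` (type I) or
`j ∈ Γ(i) \ Δ(i)` (type II) and `v_j(Γ) ≥ v_j(Δ)`, then turning `j` into a friend of `i`
preserves `i`'s strict preference of `Γ` over `Δ`, and turns indifference into weak
preference. -/
theorem sumEQ_monotonic (G : SimpleGraph (Fin n)) [DecidableRel G.Adj]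
    (i j : Fin n) (hj : j ∈ enemies G i)
    (Γ Δ : CoalitionStructure n) (hv : val G Δ j ≤ val G Γ j)
    (hcase : (j ∈ Γ.block i ∧ j ∈ Δ.block i) ∨ (j ∈ Γ.block i ∧ j ∉ Δ.block i)) :
    (usumEQ G Δ i < usumEQ G Γ i →
        usumEQ (addEdge G i j) Δ i < usumEQ (addEdge G i j) Γ i) ∧
      (usumEQ G Γ i = usumEQ G Δ i →
        usumEQ (addEdge G i j) Δ i ≤ usumEQ (addEdge G i j) Γ i) := by
  have hΓ : j ∈ Γ.block i := hcase.elim And.left And.left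
  rw [usumEQ_addEdge hj, usumEQ_addEdge hj, if_pos hΓ]
  constructor <;> intro h <;> split_ifs <;> linarith

end ACFG
end
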